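/- Let V be a type and G : SimpleGraph V a tree (G.IsTree). Let A, B ⊆ V be nonempty disjoint sets such that the induced subgraph of G on A is connected and the induced subgraph of G on B is connected. Then there exist a ∈ A and b ∈ B such that for every x ∈ A and every y ∈ B, G.dist x y = G.dist x a + G.dist a b + G.dist b y. (The disjoint case of Lemma 3.6 of the paper ('junctures in tree products') for a single tree: the junctures of two disjoint subtrees are their unique points of closest approach, and distances between the subtrees split exactly through these gates.) -/

import Mathlib

theorem aux_append_isPath {V : Type*} {G : SimpleGraph V} {u v w : V}
    (p : G.Walk u v) (q : G.Walk v w) (hp : p.IsPath) (hq : q.IsPath)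
    (h : ∀ z ∈ p.support, z ∈ q.support → z = v) : (p.append q).IsPath := by
  rw [SimpleGraph.Walk.isPath_def] at *
  rw [SimpleGraph.Walk.support_append, List.nodup_append']
  refine ⟨hp, hq.tail, fun z hz hz' => ?_⟩
  have := h z hz (List.mem_of_mem_tail hz')
  subst this
  rw [← q.cons_tail_support] at hq
  exact (List.nodup_cons.1 hq).1 hz'

theorem aux_dist_eq {V : Type*} {G : SimpleGraph V} (hT : G.IsTree) {u v : V}
    (p : G.Walk u v) (hp : p.IsPath) : p.length = G.dist u v := by
  obtain ⟨q, hq, hl⟩ := hT.1.exists_path_of_dist u v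
  rw [← hl, (hT.existsUnique_path u v).unique hp hq]

theorem aux_path_in {V : Type*} {G : SimpleGraph V} {A : Set V}
    (hA : (G.induce A).Connected) {x a : V} (hx : x ∈ A) (ha : a ∈ A) :
    ∃ p : G.Walk x a, p.IsPath ∧ ∀ z ∈ p.support, z ∈ A := by
  obtain ⟨p, hp, -⟩ := hA.exists_path_of_dist ⟨x, hx⟩ ⟨a, ha⟩
  refine ⟨p.map (SimpleGraph.Embedding.induce A).toHom,
    SimpleGraph.Walk.map_isPath_of_injective (f := (SimpleGraph.Embedding.induce A).toHom) Subtype.val_injective hp, ?_⟩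
  intro z hz
  replace hz := List.mem_map.1 ((SimpleGraph.Walk.support_map
    (SimpleGraph.Embedding.induce A).toHom p) ▸ hz)
  obtain ⟨y, -, rfl⟩ := hz
  exact y.2

/-- Disjoint case of Lemma 3.6 for a single tree: two disjoint connected subsets
of a tree have unique gates through which all distances between them split. -/
theorem disjoint_subtrees_have_gates
    {V : Type*} (G : SimpleGraph V) (hT : G.IsTree)
    (A B : Set V) (hA : A.Nonempty) (hB : B.Nonempty) (hAB : Disjoint A B)
    (hAconn : (G.induce A).Connected) (hBconn : (G.induce B).Connected) :
    ∃ a ∈ A, ∃ b ∈ B, ∀ x ∈ A, ∀ y ∈ B,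
      G.dist x y = G.dist x a + G.dist a b + G.dist b y := by
  classical
  obtain ⟨⟨a, b⟩, ⟨ha, hb⟩, hmin⟩ := exists_minimal_of_wellFoundedLT
    (fun n : ℕ => ∃ c : V × V, (c.1 ∈ A ∧ c.2 ∈ B) ∧ G.dist c.1 c.2 = n)
    ⟨_, (hA.some, hB.some), ⟨hA.some_mem, hB.some_mem⟩, rfl⟩ |>.elim (fun n hn => by
      obtain ⟨⟨c, hc, rfl⟩, h⟩ := hn
      exact (⟨c, hc, fun a' ha' b' hb' => by
        by_contra! hlt
        have : G.dist c.1 c.2 ≤ G.dist a' b' := h ⟨(a', b'), ⟨ha', hb'⟩, rfl⟩ hlt.le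
        omega⟩ : ∃ c : V × V, (c.1 ∈ A ∧ c.2 ∈ B) ∧
          ∀ a' ∈ A, ∀ b' ∈ B, G.dist c.1 c.2 ≤ G.dist a' b'))
  simp only at ha hb hmin
  refine ⟨a, ha, b, hb, fun x hx y hy => ?_⟩
  obtain ⟨P, hP, hPl⟩ := hT.1.exists_path_of_dist a b
  obtain ⟨p, hp, hpA⟩ := aux_path_in hAconn hx ha
  obtain ⟨q, hq, hqB⟩ := aux_path_in hBconn hb hy
  have key : ∀ z ∈ P.support, G.dist a z + G.dist z b ≤ G.dist a b := by
    intro z hz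
    have h1 := congrArg SimpleGraph.Walk.length (P.take_spec hz)
    rw [SimpleGraph.Walk.length_append] at h1
    have h2 := SimpleGraph.dist_le (P.takeUntil z hz)
    have h3 := SimpleGraph.dist_le (P.dropUntil z hz)
    omega
  have hPA : ∀ z ∈ P.support, z ∈ A → z = a := by
    intro z hz hzA
    have h1 := key z hz
    have h2 := hmin z hzA b hb
    exact (hT.1.dist_eq_zero_iff.1 (by omega : G.dist a z = 0)).symm
  have hPB : ∀ z ∈ P.support, z ∈ B → z = b := by
    intro z hz hzB
    have h1 := key z hz
    have h2 := hmin a ha z hzB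
    exact hT.1.dist_eq_zero_iff.1 (by omega : G.dist z b = 0)
  have h1 := aux_append_isPath P q hP hq (fun z hz hz' => hPB z hz (hqB z hz'))
  have h2 := aux_append_isPath p (P.append q) hp h1 (fun z hz hz' => by
    rcases (SimpleGraph.Walk.mem_support_append_iff _ _).1 hz' with h | h
    · exact hPA z h (hpA z hz)
    · exact (Set.disjoint_left.1 hAB (hpA z hz) (hqB z h)).elim)
  have h3 := aux_dist_eq hT _ h2
  rw [SimpleGraph.Walk.length_append, SimpleGraph.Walk.length_append, aux_dist_eq hT p hp,
    aux_dist_eq hT P hP, aux_dist_eq hT q hq] at h3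
  omega
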